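/- arXiv:1802.04544 — 2 statements merged into one kernel-verified Lean document; each statement's English description precedes it below -/
import Mathlib

section
/- Every Boolean function on n variables representable by an unambiguous nondeterministic OBDD of size polynomial in n can be represented by a structured deterministic DNNF (a deterministic DNNF respecting some vtree) of size polynomial in n. -/
namespace BDDPaper

/-- Labels of nodes in a (nondeterministic) binary decision diagram over
variables indexed by `Fin n`. -/
inductive BLabel (n : ℕ) where
  | decision (i : Fin n)
  | orNode
  | sink (b : Bool)
  deriving DecidableEq

/-- A nondeterministic binary decision diagram (with nodes listed in a
topological order, i.e. all edges lead to nodes of larger index, which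
encodes acyclicity). Decision nodes have the two successors `succ0`/`succ1`;
`∨`-nodes have the (unlabeled) successors `orSucc`. -/
structure NBDD (n : ℕ) where
  size : ℕ
  label : Fin size → BLabel n
  succ0 : Fin size → Fin size
  succ1 : Fin size → Fin size
  orSucc : Fin size → Finset (Fin size)
  source : Fin size
  succ0_lt : ∀ u i, label u = .decision i → u < succ0 u
  succ1_lt : ∀ u i, label u = .decision i → u < succ1 u
  orSucc_lt : ∀ u v, label u = .orNode → v ∈ orSucc u → u < v

namespace NBDD

variable {n : ℕ} (G : NBDD n)

/-- The edge relation of the diagram. -/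
def Edge (u v : Fin G.size) : Prop :=
  (∃ i, G.label u = .decision i ∧ (v = G.succ0 u ∨ v = G.succ1 u)) ∨
  (G.label u = .orNode ∧ v ∈ G.orSucc u)

/-- The edges activated by an input `b`. -/
def Active (b : Fin n → Bool) (u v : Fin G.size) : Prop :=
  (∃ i, G.label u = .decision i ∧ v = (if b i then G.succ1 u else G.succ0 u)) ∨
  (G.label u = .orNode ∧ v ∈ G.orSucc u)

/-- `p` is a path of edges activated by `b` starting at node `s`. -/
def IsPathFrom (b : Fin n → Bool) (s : Fin G.size) (p : List (Fin G.size)) : Prop :=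
  p.head? = some s ∧ List.Chain' (G.Active b) p

/-- The path `p` ends in the 1-sink. -/
def EndsAccepting (p : List (Fin G.size)) : Prop :=
  ∃ v, p.getLast? = some v ∧ G.label v = .sink true

/-- There is a path of edges activated by `b` from `s` to the 1-sink. -/
def AcceptsFrom (b : Fin n → Bool) (s : Fin G.size) : Prop :=
  ∃ p, G.IsPathFrom b s p ∧ G.EndsAccepting p

/-- `p` is an accepting path for the input `b`. -/
def AcceptingPath (b : Fin n → Bool) (p : List (Fin G.size)) : Prop :=
  G.IsPathFrom b G.source p ∧ G.EndsAccepting p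

/-- The diagram accepts the input `b`. -/
def Accepts (b : Fin n → Bool) : Prop := ∃ p, G.AcceptingPath b p

/-- The diagram represents the Boolean function `f`. -/
def Represents (f : (Fin n → Bool) → Bool) : Prop :=
  ∀ b, f b = true ↔ G.Accepts b

/-- The diagram is unambiguous nondeterministic: every input has at most one
accepting path. -/
def Unambiguous : Prop :=
  ∀ b p q, G.AcceptingPath b p → G.AcceptingPath b q → p = q

/-- The diagram is deterministic, i.e. an ordinary BDD: it has no `∨`-nodes. -/
def Deterministic : Prop := ∀ u, G.label u ≠ .orNode

/-- The diagram respects the variable ordering given by the strict order `r`: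
along every directed path the labels of the decision nodes form a subsequence
of the ordering, i.e. they strictly increase w.r.t. `r`. -/
def IsOBDDRel (r : Fin n → Fin n → Prop) : Prop :=
  ∀ u v i j, Relation.TransGen G.Edge u v →
    G.label u = .decision i → G.label v = .decision j → r i j

/-- The diagram is ordered w.r.t. the variable ordering `π` (position `p` of the
ordering holds the variable `π p`). -/
def IsOBDD (π : Equiv.Perm (Fin n)) : Prop :=
  G.IsOBDDRel fun i j => π.symm i < π.symm j

/-- Free BDD condition: on every directed path every variable is tested at most
once. -/
def IsFBDD : Prop :=
  ∀ u v i j, Relation.TransGen G.Edge u v →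
    G.label u = .decision i → G.label v = .decision j → i ≠ j

/-- `u` is an internal node (not a sink). -/
def IsInternal (u : Fin G.size) : Prop := ∀ c : Bool, G.label u ≠ .sink c

/-- The set of variables appearing (as decision-node labels) in the subgraph
rooted at `u`. -/
def varsAt (u : Fin G.size) : Set (Fin n) :=
  {i | ∃ v, Relation.ReflTransGen G.Edge u v ∧ G.label v = .decision i}

end NBDD

end BDDPaper
namespace BDDPaper

/-- A vtree over variables indexed by `Fin n`: a full rooted binary tree whose
leaves are labeled by variables. -/
inductive Vtree (n : ℕ) where
  | leaf (i : Fin n)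
  | node (l r : Vtree n)
  deriving DecidableEq

namespace Vtree

/-- The list of variables at the leaves (left-to-right). -/
def varsList {n : ℕ} : Vtree n → List (Fin n)
  | leaf i => [i]
  | node l r => l.varsList ++ r.varsList

/-- `T` is a vtree for the variable set `Fin n`: its leaves are in one-to-one
correspondence with the variables. -/
def IsVtreeFor {n : ℕ} (T : Vtree n) : Prop :=
  T.varsList.Nodup ∧ ∀ i : Fin n, i ∈ T.varsList

/-- The list of all subtree occurrences of a vtree. -/
def subtrees {n : ℕ} : Vtree n → List (Vtree n)
  | leaf i => [leaf i]
  | node l r => node l r :: (l.subtrees ++ r.subtrees)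

/-- `S` occurs as a subtree (a node) of `T`. -/
def Subtree {n : ℕ} (T S : Vtree n) : Prop := S ∈ T.subtrees

end Vtree

end BDDPaper
namespace BDDPaper

/-- Labels of gates in a negation normal form circuit over variables indexed
by `Fin n`. -/
inductive NLabel (n : ℕ) where
  | lit (i : Fin n) (pos : Bool)
  | const (b : Bool)
  | andG
  | orG
  deriving DecidableEq

/-- A negation normal form circuit (NNF), given as a DAG whose nodes are
listed in a reverse topological order: the children of every gate have smaller
indices (this encodes acyclicity). `∧`-gates have fanin 2 (children `andL`,
`andR`), `∨`-gates have unbounded fanin (children `orSucc`). -/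
structure NNF (n : ℕ) where
  size : ℕ
  label : Fin size → NLabel n
  andL : Fin size → Fin size
  andR : Fin size → Fin size
  orSucc : Fin size → Finset (Fin size)
  root : Fin size
  andL_lt : ∀ u, label u = .andG → andL u < u
  andR_lt : ∀ u, label u = .andG → andR u < u
  orSucc_lt : ∀ u v, label u = .orG → v ∈ orSucc u → v < u

namespace NNF

variable {n : ℕ} (D : NNF n)

/-- The child (wire) relation of the circuit. -/
def CEdge (u v : Fin D.size) : Prop :=
  (D.label u = .andG ∧ (v = D.andL u ∨ v = D.andR u)) ∨
  (D.label u = .orG ∧ v ∈ D.orSucc u)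

/-- `SatAt D a u` holds iff the gate `u` of `D` evaluates to `1` under the
assignment `a`. -/
inductive SatAt (a : Fin n → Bool) : Fin D.size → Prop where
  | lit {u : Fin D.size} {i : Fin n} {pos : Bool} :
      D.label u = .lit i pos → a i = pos → SatAt a u
  | const {u : Fin D.size} : D.label u = .const true → SatAt a u
  | and {u : Fin D.size} : D.label u = .andG →
      SatAt a (D.andL u) → SatAt a (D.andR u) → SatAt a u
  | or {u v : Fin D.size} : D.label u = .orG → v ∈ D.orSucc u →
      SatAt a v → SatAt a u

/-- The circuit `D` represents the Boolean function `f`. -/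
def Represents (f : (Fin n → Bool) → Bool) : Prop :=
  ∀ a, f a = true ↔ D.SatAt a D.root

/-- The set of variables appearing in the subcircuit rooted at `u`. -/
def varsAt (u : Fin D.size) : Set (Fin n) :=
  {i | ∃ v pos, Relation.ReflTransGen D.CEdge u v ∧ D.label v = .lit i pos}

/-- Decomposability: the children of every `∧`-gate are reachable from
disjoint sets of variables. -/
def Decomposable : Prop :=
  ∀ u, D.label u = .andG → Disjoint (D.varsAt (D.andL u)) (D.varsAt (D.andR u))

/-- Determinism: the functions computed at the children of every `∨`-gate are
pairwise not simultaneously satisfiable. -/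
def Deterministic : Prop :=
  ∀ u v w, D.label u = .orG → v ∈ D.orSucc u → w ∈ D.orSucc u → v ≠ w →
    ∀ a, ¬ (D.SatAt a v ∧ D.SatAt a w)

/-- `D` respects the vtree `T`: for every `∧`-node `u` there is a node
`node L R` of `T` with `vars(u_l) ⊆ vars(L)` and `vars(u_r) ⊆ vars(R)`. -/
def RespectsVtree (T : Vtree n) : Prop :=
  ∀ u, D.label u = .andG → ∃ L R : Vtree n, T.Subtree (.node L R) ∧
    D.varsAt (D.andL u) ⊆ {i | i ∈ L.varsList} ∧
    D.varsAt (D.andR u) ⊆ {i | i ∈ R.varsList}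

end NNF

end BDDPaper
namespace BDDPaper

namespace NBDD

variable {n : ℕ} (G : NBDD n)

/-- `p` is a path from `u` to the 1-sink activated by `b`. -/
def AcceptingPathFrom (b : Fin n → Bool) (u : Fin G.size) (p : List (Fin G.size)) : Prop :=
  G.IsPathFrom b u p ∧ G.EndsAccepting p

/-- The successor of a decision node along the edge labeled `c`. -/
def branch (u : Fin G.size) (c : Bool) : Fin G.size :=
  if c then G.succ1 u else G.succ0 u

/-- `u` can be reached from the source. -/
def Reachable (u : Fin G.size) : Prop := Relation.ReflTransGen G.Edge G.source u

variable {G}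

lemma lt_branch {u : Fin G.size} {i : Fin n} (hu : G.label u = .decision i) (c : Bool) :
    u < G.branch u c := by
  cases c
  · exact G.succ0_lt u i hu
  · exact G.succ1_lt u i hu

lemma edge_branch {u : Fin G.size} {i : Fin n} (hu : G.label u = .decision i) (c : Bool) :
    G.Edge u (G.branch u c) := by
  refine Or.inl ⟨i, hu, ?_⟩
  cases c <;> simp [branch]

lemma Edge.exists_branch {u v : Fin G.size} (h : G.Edge u v) :
    (∃ i c, G.label u = .decision i ∧ v = G.branch u c) ∨
      (G.label u = .orNode ∧ v ∈ G.orSucc u) := by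
  rcases h with ⟨i, hi, rfl | rfl⟩ | h
  · exact Or.inl ⟨i, false, hi, rfl⟩
  · exact Or.inl ⟨i, true, hi, rfl⟩
  · exact Or.inr h

lemma active_decision {u v : Fin G.size} {i : Fin n} (hu : G.label u = .decision i)
    {b : Fin n → Bool} : G.Active b u v ↔ v = G.branch u (b i) := by
  constructor
  · rintro (⟨j, hj, rfl⟩ | ⟨h, -⟩)
    · rw [hu] at hj
      cases hj
      rfl
    · rw [hu] at h
      cases h
  · rintro rfl
    exact Or.inl ⟨i, hu, rfl⟩

lemma active_orNode {u v : Fin G.size} (hu : G.label u = .orNode) {b : Fin n → Bool} :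
    G.Active b u v ↔ v ∈ G.orSucc u := by
  simp [Active, hu]

lemma Active.edge {u v : Fin G.size} {b : Fin n → Bool} (h : G.Active b u v) : G.Edge u v := by
  rcases h with ⟨i, hi, rfl⟩ | h
  · exact edge_branch hi (b i)
  · exact Or.inr h

lemma varsAt_subset_of_edge {u v : Fin G.size} (h : G.Edge u v) : G.varsAt v ⊆ G.varsAt u := by
  rintro i ⟨w, hw, hi⟩
  exact ⟨w, hw.head h, hi⟩

lemma mem_varsAt_self {u : Fin G.size} {i : Fin n} (hu : G.label u = .decision i) :
    i ∈ G.varsAt u :=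
  ⟨u, .refl, hu⟩

lemma acceptingPathFrom_cons {b : Fin n → Bool} {u v : Fin G.size} {p : List (Fin G.size)}
    (h : G.Active b u v) (hp : G.AcceptingPathFrom b v p) :
    G.AcceptingPathFrom b u (u :: p) := by
  obtain ⟨⟨hh, hc⟩, w, hl, hw⟩ := hp
  cases p with
  | nil => simp at hh
  | cons x p =>
    simp only [List.head?_cons, Option.some.injEq] at hh
    subst hh
    refine ⟨⟨rfl, ?_⟩, w, by simpa using hl, hw⟩
    exact List.isChain_cons_cons.2 ⟨h, hc⟩

lemma AcceptingPathFrom.sink_or_cons {b : Fin n → Bool} {u : Fin G.size}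
    {p : List (Fin G.size)} (hp : G.AcceptingPathFrom b u p) :
    (G.label u = .sink true) ∨
      ∃ v q, p = u :: q ∧ G.Active b u v ∧ G.AcceptingPathFrom b v q := by
  obtain ⟨⟨hh, hc⟩, w, hl, hw⟩ := hp
  match p, hh, hc, hl with
  | [x], hh, hc, hl =>
    simp only [List.head?_cons, Option.some.injEq, List.getLast?_singleton] at hh hl
    subst hh hl
    exact Or.inl hw
  | x :: y :: q, hh, hc, hl =>
    simp only [List.head?_cons, Option.some.injEq] at hh
    subst hh
    obtain ⟨h1, h2⟩ := List.isChain_cons_cons.1 hc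
    exact Or.inr ⟨y, y :: q, rfl, h1, ⟨rfl, h2⟩, w, by simpa using hl, hw⟩

lemma acceptsFrom_iff {b : Fin n → Bool} {u : Fin G.size} :
    G.AcceptsFrom b u ↔
      G.label u = .sink true ∨ ∃ v, G.Active b u v ∧ G.AcceptsFrom b v := by
  constructor
  · rintro ⟨p, hp⟩
    rcases AcceptingPathFrom.sink_or_cons hp with h | ⟨v, q, -, hv, hq⟩
    · exact Or.inl h
    · exact Or.inr ⟨v, hv, q, hq⟩
  · rintro (h | ⟨v, hv, q, hq⟩)
    · exact ⟨[u], ⟨rfl, List.isChain_singleton u⟩, u, rfl, h⟩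
    · exact ⟨u :: q, acceptingPathFrom_cons hv hq⟩

lemma acceptsFrom_sink {b : Fin n → Bool} {u : Fin G.size} {c : Bool}
    (hu : G.label u = .sink c) : G.AcceptsFrom b u ↔ c = true := by
  rw [acceptsFrom_iff]
  simp [hu, Active]

lemma acceptsFrom_decision {b : Fin n → Bool} {u : Fin G.size} {i : Fin n}
    (hu : G.label u = .decision i) :
    G.AcceptsFrom b u ↔ G.AcceptsFrom b (G.branch u (b i)) := by
  rw [acceptsFrom_iff]
  simp [hu, active_decision hu]

lemma acceptsFrom_orNode {b : Fin n → Bool} {u : Fin G.size} (hu : G.label u = .orNode) :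
    G.AcceptsFrom b u ↔ ∃ v ∈ G.orSucc u, G.AcceptsFrom b v := by
  rw [acceptsFrom_iff]
  simp [hu, active_orNode hu]

lemma Active.congr {b b' : Fin n → Bool} {u v : Fin G.size}
    (hb : ∀ i ∈ G.varsAt u, b i = b' i) (h : G.Active b u v) : G.Active b' u v := by
  rcases h with ⟨i, hi, rfl⟩ | h
  · exact Or.inl ⟨i, hi, by rw [hb i (mem_varsAt_self hi)]⟩
  · exact Or.inr h

lemma IsPathFrom.congr {b b' : Fin n → Bool} {u : Fin G.size} {p : List (Fin G.size)}
    (hb : ∀ i ∈ G.varsAt u, b i = b' i) (hp : G.IsPathFrom b u p) : G.IsPathFrom b' u p := by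
  induction p generalizing u with
  | nil => simp [IsPathFrom] at hp
  | cons x p ih =>
    obtain ⟨hh, hc⟩ := hp
    simp only [List.head?_cons, Option.some.injEq] at hh
    subst hh
    refine ⟨rfl, ?_⟩
    cases p with
    | nil => exact List.isChain_singleton _
    | cons y p =>
      obtain ⟨h1, h2⟩ := List.isChain_cons_cons.1 hc
      exact List.isChain_cons_cons.2 ⟨h1.congr hb,
        (ih (fun i hi => hb i (varsAt_subset_of_edge h1.edge hi)) ⟨rfl, h2⟩).2⟩

lemma AcceptsFrom.congr {b b' : Fin n → Bool} {u : Fin G.size}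
    (hb : ∀ i ∈ G.varsAt u, b i = b' i) (h : G.AcceptsFrom b u) : G.AcceptsFrom b' u := by
  obtain ⟨p, hp, he⟩ := h
  exact ⟨p, hp.congr hb, he⟩

lemma IsOBDDRel.rel_of_mem_varsAt {r : Fin n → Fin n → Prop} (hG : G.IsOBDDRel r)
    {u v : Fin G.size} {i j : Fin n} (hu : G.label u = .decision i) (huv : G.Edge u v)
    (hj : j ∈ G.varsAt v) : r i j := by
  obtain ⟨w, hw, hj⟩ := hj
  exact hG u w i j (Relation.TransGen.head' huv hw) hu hj

lemma IsOBDDRel.eq_or_rel {r : Fin n → Fin n → Prop} (hG : G.IsOBDDRel r)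
    {u : Fin G.size} {i j : Fin n} (hu : G.label u = .decision i)
    (hj : j ∈ G.varsAt u) : j = i ∨ r i j := by
  obtain ⟨w, hw, hj⟩ := hj
  rcases Relation.reflTransGen_iff_eq_or_transGen.1 hw with rfl | hw
  · rw [hu] at hj
    cases hj
    exact Or.inl rfl
  · exact Or.inr (hG u w i j hw hu hj)

/-- In an unambiguous ordered diagram, every reachable node has at most one accepting path
for each input. -/
lemma Unambiguous.of_reachable {r : Fin n → Fin n → Prop} [Std.Irrefl r]
    (hU : G.Unambiguous) (hG : G.IsOBDDRel r) {u : Fin G.size} (hu : G.Reachable u) :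
    ∀ b p q, G.AcceptingPathFrom b u p → G.AcceptingPathFrom b u q → p = q := by
  induction hu with
  | refl => exact hU
  | @tail u v _ huv ih =>
    intro b p q hp hq
    suffices ∃ b', G.Active b' u v ∧ ∀ i ∈ G.varsAt v, b i = b' i by
      obtain ⟨b', hA, hb⟩ := this
      exact (List.cons.inj (ih b' _ _ (acceptingPathFrom_cons hA ⟨hp.1.congr hb, hp.2⟩)
        (acceptingPathFrom_cons hA ⟨hq.1.congr hb, hq.2⟩))).2
    rcases huv.exists_branch with ⟨i, c, hi, rfl⟩ | ⟨ho, hv⟩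
    · refine ⟨Function.update b i c, (active_decision hi).2 (by simp), fun j hj => ?_⟩
      have hij : j ≠ i := by
        rintro rfl
        exact irrefl_of r j (hG.rel_of_mem_varsAt hi huv hj)
      simp [hij]
    · exact ⟨b, (active_orNode ho).2 hv, fun _ _ => rfl⟩

end NBDD

namespace Vtree

variable {n : ℕ}

/-- The right-linear vtree whose leaves are, from left to right, the members of `i :: l`. -/
def caterpillar : Fin n → List (Fin n) → Vtree n
  | i, [] => leaf i
  | i, j :: l => node (leaf i) (caterpillar j l)

@[simp]
lemma varsList_caterpillar (i : Fin n) (l : List (Fin n)) :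
    (caterpillar i l).varsList = i :: l := by
  induction l generalizing i with
  | nil => rfl
  | cons j l ih => simp [caterpillar, varsList, ih]

lemma exists_subtree_caterpillar {r : Fin n → Fin n → Prop} [Std.Irrefl r] [IsTrans (Fin n) r]
    {i : Fin n} {l : List (Fin n)} (hl : (i :: l).Pairwise r) {x y : Fin n}
    (hx : x ∈ i :: l) (hy : y ∈ i :: l) (hxy : r x y) :
    ∃ R, (caterpillar i l).Subtree (node (leaf x) R) ∧
      ∀ z ∈ i :: l, r x z → z ∈ R.varsList := by
  induction l generalizing i with
  | nil =>
    simp only [List.mem_singleton] at hx hy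
    subst hx hy
    exact absurd hxy (irrefl_of r _)
  | cons j l ih =>
    rw [List.pairwise_cons] at hl
    rcases List.mem_cons.1 hx with rfl | hxl
    · refine ⟨caterpillar j l, by simp [Subtree, caterpillar, subtrees], fun z hz hxz => ?_⟩
      rcases List.mem_cons.1 hz with rfl | hz
      · exact absurd hxz (irrefl_of r _)
      · simpa using hz
    · have key : ∀ z ∈ i :: j :: l, r x z → z ∈ j :: l := by
        intro z hz hxz
        rcases List.mem_cons.1 hz with rfl | hz
        · exact absurd (trans_of r hxz (hl.1 x hxl)) (irrefl_of r _)
        · exact hz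
      obtain ⟨R, hR, hR'⟩ := ih hl.2 hxl (key y hy hxy)
      refine ⟨R, ?_, fun z hz hxz => hR' z (key z hz hxz) hxz⟩
      simp only [Subtree, caterpillar, subtrees, List.mem_cons, List.mem_append]
      exact Or.inr (Or.inr hR)

/-- There is a vtree that, for every variable `x` that is not last in the ordering `π`, splits
`x` from all variables that come after it. -/
lemma exists_isVtreeFor (hn : 0 < n) (π : Equiv.Perm (Fin n)) :
    ∃ T : Vtree n, T.IsVtreeFor ∧ ∀ x y, π.symm x < π.symm y →
      ∃ R, T.Subtree (node (leaf x) R) ∧ ∀ z, π.symm x < π.symm z → z ∈ R.varsList := by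
  let r : Fin n → Fin n → Prop := fun i j => π.symm i < π.symm j
  have : Std.Irrefl r := ⟨fun i => lt_irrefl (π.symm i)⟩
  have : IsTrans (Fin n) r := ⟨fun _ _ _ h h' => lt_trans (a := π.symm _) h h'⟩
  have hmem : ∀ i, i ∈ (List.finRange n).map π := fun i => by
    simpa using ⟨π.symm i, by simp⟩
  have hpair : ((List.finRange n).map π).Pairwise r := by
    rw [List.pairwise_map]
    simpa [r] using List.pairwise_lt_finRange n
  have hnodup : ((List.finRange n).map π).Nodup :=
    (List.nodup_finRange n).map π.injective
  generalize (List.finRange n).map π = m at hmem hpair hnodup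
  cases m with
  | nil => simpa using hmem ⟨0, hn⟩
  | cons i l =>
    refine ⟨caterpillar i l, ⟨by simpa using hnodup, by simpa using hmem⟩, fun x y hxy => ?_⟩
    obtain ⟨R, hR, hR'⟩ := exists_subtree_caterpillar hpair (hmem x) (hmem y) hxy
    exact ⟨R, hR, fun z => hR' z (hmem z)⟩

end Vtree

namespace NNF

variable {n : ℕ} {D : NNF n} {a : Fin n → Bool} {u : Fin D.size}

lemma satAt_lit {i : Fin n} {c : Bool} (h : D.label u = .lit i c) :
    D.SatAt a u ↔ a i = c := by
  refine ⟨fun hs => ?_, .lit h⟩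
  cases hs <;> simp_all

lemma satAt_const {c : Bool} (h : D.label u = .const c) : D.SatAt a u ↔ c = true := by
  constructor
  · intro hs
    cases hs <;> simp_all
  · rintro rfl
    exact .const h

lemma satAt_andG (h : D.label u = .andG) :
    D.SatAt a u ↔ D.SatAt a (D.andL u) ∧ D.SatAt a (D.andR u) := by
  refine ⟨fun hs => ?_, fun hs => .and h hs.1 hs.2⟩
  cases hs <;> simp_all

lemma satAt_orG (h : D.label u = .orG) :
    D.SatAt a u ↔ ∃ v ∈ D.orSucc u, D.SatAt a v := by
  constructor
  · intro hs
    cases hs with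
    | or _ hv hs => exact ⟨_, hv, hs⟩
    | _ => simp_all
  · rintro ⟨v, hv, hs⟩
    exact .or h hv hs

/-- An upper bound on the variables below each gate that is monotone along wires. -/
lemma varsAt_subset_of_monotone (V : Fin D.size → Set (Fin n))
    (hlit : ∀ v i c, D.label v = .lit i c → i ∈ V v)
    (hedge : ∀ v w, D.CEdge v w → V w ⊆ V v) (u : Fin D.size) : D.varsAt u ⊆ V u := by
  rintro i ⟨v, c, huv, hv⟩
  induction huv using Relation.ReflTransGen.head_induction_on with
  | refl => exact hlit v i c hv
  | head h _ ih => exact hedge _ _ h ih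

end NNF

/-- The gates that simulate a single node of a diagram: a literal and a conjunction for each
value of the tested variable, and the gate computing the function of the node. -/
inductive GateKind where
  | lit (c : Bool)
  | branch (c : Bool)
  | main

namespace GateKind

/-- An enumeration of the gate kinds in which children precede their parents. -/
def equivFin : GateKind ≃ Fin 5 where
  toFun
    | lit false => 0
    | lit true => 1
    | branch false => 2
    | branch true => 3
    | main => 4
  invFun
    | 0 => lit false
    | 1 => lit true
    | 2 => branch false
    | 3 => branch true
    | 4 => main
  left_inv k := by rcases k with (_ | _) | (_ | _) | _ <;> rfl
  right_inv k := by fin_cases k <;> rfl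

/-- An enumeration of all simulating gates for `s` nodes; later nodes come first. -/
def equiv (s : ℕ) : Fin s × GateKind ≃ Fin (s * 5) :=
  (Equiv.prodCongr Fin.revPerm equivFin).trans finProdFinEquiv

lemma equiv_lt_of_lt {s : ℕ} {u v : Fin s} (h : v < u) (k l : GateKind) :
    equiv s (u, k) < equiv s (v, l) := by
  have hk := (equivFin k).isLt
  rw [Fin.lt_def] at h ⊢
  simp only [equiv, Equiv.trans_apply, Equiv.prodCongr_apply, Prod.map_apply,
    finProdFinEquiv_apply_val, Fin.revPerm_apply, Fin.val_rev]
  have := u.isLt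
  omega

lemma equiv_lt_of_kind_lt {s : ℕ} (u : Fin s) {k l : GateKind} (h : equivFin k < equivFin l) :
    equiv s (u, k) < equiv s (u, l) := by
  rw [Fin.lt_def] at h ⊢
  simpa [equiv] using h

end GateKind

namespace NBDD

variable {n : ℕ} (G : NBDD n) (π : Equiv.Perm (Fin n))

open GateKind

/-- No variable comes after `i` in the ordering `π`. -/
def IsLast (i : Fin n) : Prop := ∀ j, ¬ π.symm i < π.symm j

open Classical in
/-- The labels of the gates simulating a node. Branches on the last variable are replaced by
literals or constants, since the vtree may offer no place to split off that variable. -/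
noncomputable def gateLabel : Fin G.size × GateKind → NLabel n
  | (u, k) =>
    match G.label u, k with
    | .decision i, .lit c => .lit i c
    | .decision i, .branch c =>
      if IsLast π i then
        if G.AcceptsFrom (fun _ => c) u then .lit i c else .const false
      else .andG
    | .decision _, .main => .orG
    | .orNode, .main => .orG
    | .sink c, .main => .const c
    | _, _ => .const false

open Classical in
/-- The children of the disjunctions simulating a node. -/
noncomputable def gateOrSucc : Fin G.size × GateKind → Finset (Fin (G.size * 5))
  | (u, _) =>
    match G.label u with
    | .decision _ => {equiv G.size (u, .branch false), equiv G.size (u, .branch true)}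
    | .orNode =>
      if G.Reachable u then (G.orSucc u).image fun v => equiv G.size (v, .main) else ∅
    | .sink _ => ∅

/-- The left child of the conjunctions simulating a node. -/
def gateAndL : Fin G.size × GateKind → Fin (G.size * 5)
  | (u, .branch c) => equiv G.size (u, .lit c)
  | (u, k) => equiv G.size (u, k)

/-- The right child of the conjunctions simulating a node. -/
def gateAndR : Fin G.size × GateKind → Fin (G.size * 5)
  | (u, .branch c) => equiv G.size (G.branch u c, .main)
  | (u, k) => equiv G.size (u, k)

variable {G π}

lemma gateLabel_eq_andG {u : Fin G.size} {k : GateKind} (h : G.gateLabel π (u, k) = .andG) :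
    ∃ i c, G.label u = .decision i ∧ k = .branch c ∧ ¬ IsLast π i := by
  rcases hu : G.label u with i | _ | b <;> rcases k with c | c | _ <;>
    simp only [gateLabel, hu] at h <;> try cases h
  split_ifs at h with h1 h2
  exact ⟨i, c, rfl, rfl, h1⟩

lemma gateLabel_eq_orG {u : Fin G.size} {k : GateKind} (h : G.gateLabel π (u, k) = .orG) :
    k = .main ∧ ((∃ i, G.label u = .decision i) ∨ G.label u = .orNode) := by
  rcases hu : G.label u with i | _ | b <;> rcases k with c | c | _ <;>
    simp only [gateLabel, hu] at h <;> try cases h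
  · split_ifs at h
  · exact ⟨rfl, Or.inl ⟨i, rfl⟩⟩
  · exact ⟨rfl, Or.inr rfl⟩

lemma gateLabel_eq_lit {u : Fin G.size} {k : GateKind} {i : Fin n} {c : Bool}
    (h : G.gateLabel π (u, k) = .lit i c) : G.label u = .decision i := by
  rcases hu : G.label u with j | _ | b <;> rcases k with d | d | _ <;>
    simp only [gateLabel, hu] at h <;> try cases h
  · rfl
  · split_ifs at h
    cases h
    rfl

lemma mem_gateOrSucc_decision {u : Fin G.size} {i : Fin n} (hu : G.label u = .decision i)
    {k : GateKind} {g : Fin (G.size * 5)} :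
    g ∈ G.gateOrSucc (u, k) ↔ ∃ c, g = equiv G.size (u, .branch c) := by
  simp [gateOrSucc, hu]

lemma mem_gateOrSucc_orNode {u : Fin G.size} (hu : G.label u = .orNode)
    {k : GateKind} {g : Fin (G.size * 5)} :
    g ∈ G.gateOrSucc (u, k) ↔
      G.Reachable u ∧ ∃ v ∈ G.orSucc u, g = equiv G.size (v, .main) := by
  by_cases h : G.Reachable u <;> simp [gateOrSucc, hu, h, eq_comm]

variable (G π)

/-- The circuit simulating an ordered diagram. -/
noncomputable def toNNF : NNF n where
  size := G.size * 5
  label g := G.gateLabel π ((equiv G.size).symm g)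
  andL g := G.gateAndL ((equiv G.size).symm g)
  andR g := G.gateAndR ((equiv G.size).symm g)
  orSucc g := G.gateOrSucc ((equiv G.size).symm g)
  root := equiv G.size (G.source, .main)
  andL_lt g h := by
    obtain ⟨⟨u, k⟩, rfl⟩ := (equiv G.size).surjective g
    rw [Equiv.symm_apply_apply] at h ⊢
    obtain ⟨i, c, -, rfl, -⟩ := gateLabel_eq_andG h
    exact equiv_lt_of_kind_lt u (by cases c <;> decide)
  andR_lt g h := by
    obtain ⟨⟨u, k⟩, rfl⟩ := (equiv G.size).surjective g
    rw [Equiv.symm_apply_apply] at h ⊢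
    obtain ⟨i, c, hu, rfl, -⟩ := gateLabel_eq_andG h
    exact equiv_lt_of_lt (lt_branch hu c) _ _
  orSucc_lt g g' h hg := by
    obtain ⟨⟨u, k⟩, rfl⟩ := (equiv G.size).surjective g
    rw [Equiv.symm_apply_apply] at h hg
    obtain ⟨rfl, ⟨i, hu⟩ | hu⟩ := gateLabel_eq_orG h
    · obtain ⟨c, rfl⟩ := (mem_gateOrSucc_decision hu).1 hg
      exact equiv_lt_of_kind_lt u (by cases c <;> decide)
    · obtain ⟨-, v, hv, rfl⟩ := (mem_gateOrSucc_orNode hu).1 hg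
      exact equiv_lt_of_lt (G.orSucc_lt u v hu hv) _ _

variable {G π}

/-- The gate of `G.toNNF π` of kind `k` that belongs to the node `u`. -/
def gate (G : NBDD n) (π : Equiv.Perm (Fin n)) (u : Fin G.size) (k : GateKind) :
    Fin (G.toNNF π).size :=
  equiv G.size (u, k)

lemma exists_eq_gate (g : Fin (G.toNNF π).size) : ∃ u k, g = gate G π u k := by
  obtain ⟨⟨u, k⟩, rfl⟩ := (equiv G.size).surjective g
  exact ⟨u, k, rfl⟩

lemma label_gate (u : Fin G.size) (k : GateKind) :
    (G.toNNF π).label (gate G π u k) = G.gateLabel π (u, k) := by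
  simp [toNNF, gate]

lemma label_gate_lit {u : Fin G.size} {i : Fin n} (hu : G.label u = .decision i) {c : Bool} :
    (G.toNNF π).label (gate G π u (.lit c)) = .lit i c := by
  simp [label_gate, gateLabel, hu]

lemma andL_gate (u : Fin G.size) (c : Bool) :
    (G.toNNF π).andL (gate G π u (.branch c)) = gate G π u (.lit c) := by
  simp [toNNF, gate, gateAndL]

lemma andR_gate (u : Fin G.size) (c : Bool) :
    (G.toNNF π).andR (gate G π u (.branch c)) = gate G π (G.branch u c) .main := by
  simp [toNNF, gate, gateAndR]

lemma orSucc_gate (u : Fin G.size) (k : GateKind) :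
    (G.toNNF π).orSucc (gate G π u k) = G.gateOrSucc (u, k) := by
  simp [toNNF, gate]

lemma mem_orSucc_decision {u : Fin G.size} {i : Fin n} (hu : G.label u = .decision i)
    {k : GateKind} {g : Fin (G.toNNF π).size} :
    g ∈ (G.toNNF π).orSucc (gate G π u k) ↔ ∃ c, g = gate G π u (.branch c) := by
  rw [orSucc_gate]
  exact mem_gateOrSucc_decision hu

lemma mem_orSucc_orNode {u : Fin G.size} (hu : G.label u = .orNode)
    {k : GateKind} {g : Fin (G.toNNF π).size} :
    g ∈ (G.toNNF π).orSucc (gate G π u k) ↔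
      G.Reachable u ∧ ∃ v ∈ G.orSucc u, g = gate G π v .main := by
  rw [orSucc_gate]
  exact mem_gateOrSucc_orNode hu

lemma IsOBDD.acceptsFrom_last (hG : G.IsOBDD π) {u : Fin G.size} {i : Fin n}
    (hu : G.label u = .decision i) (hi : IsLast π i) {a b : Fin n → Bool} (hab : a i = b i)
    (h : G.AcceptsFrom a u) : G.AcceptsFrom b u := by
  refine h.congr fun j hj => ?_
  rcases IsOBDDRel.eq_or_rel hG hu hj with rfl | hj
  · exact hab
  · exact absurd hj (hi j)

lemma eq_of_satAt_branch {u : Fin G.size} {i : Fin n} (hu : G.label u = .decision i)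
    {c : Bool} {a : Fin n → Bool} (hs : (G.toNNF π).SatAt a (gate G π u (.branch c))) :
    a i = c := by
  have hl := label_gate (π := π) u (.branch c)
  simp only [gateLabel, hu] at hl
  split_ifs at hl
  · exact (NNF.satAt_lit hl).1 hs
  · simpa using (NNF.satAt_const hl).1 hs
  · rw [NNF.satAt_andG hl, andL_gate, NNF.satAt_lit (label_gate_lit hu)] at hs
    exact hs.1

lemma IsOBDD.satAt_branch (hG : G.IsOBDD π) {u : Fin G.size} {i : Fin n}
    (hu : G.label u = .decision i) {c : Bool} {a : Fin n → Bool}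
    (ih : (G.toNNF π).SatAt a (gate G π (G.branch u c) .main) ↔
      G.AcceptsFrom a (G.branch u c)) :
    (G.toNNF π).SatAt a (gate G π u (.branch c)) ↔
      a i = c ∧ G.AcceptsFrom a (G.branch u c) := by
  have hl := label_gate (π := π) u (.branch c)
  simp only [gateLabel, hu] at hl
  have hacc : a i = c → (G.AcceptsFrom a u ↔ G.AcceptsFrom a (G.branch u c)) := by
    rintro rfl
    exact acceptsFrom_decision hu
  split_ifs at hl with hi h
  · rw [NNF.satAt_lit hl]
    refine ⟨fun hc => ⟨hc, (hacc hc).1 ?_⟩, And.left⟩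
    exact hG.acceptsFrom_last hu hi hc.symm h
  · rw [NNF.satAt_const hl]
    refine ⟨fun h => by simp at h, fun ⟨hc, h'⟩ => absurd ?_ h⟩
    exact hG.acceptsFrom_last hu hi hc ((hacc hc).2 h')
  · rw [NNF.satAt_andG hl, andL_gate, andR_gate, ih, NNF.satAt_lit (label_gate_lit hu)]

lemma IsOBDD.satAt_main (hG : G.IsOBDD π) (a : Fin n → Bool) (u : Fin G.size)
    (hr : G.Reachable u) :
    (G.toNNF π).SatAt a (gate G π u .main) ↔ G.AcceptsFrom a u := by
  have hl := label_gate (π := π) u .main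
  rcases hu : G.label u with i | _ | c <;> simp only [gateLabel, hu] at hl
  · have key c := hG.satAt_branch hu
      (hG.satAt_main a (G.branch u c) (hr.tail (edge_branch hu c)))
    simp only [NNF.satAt_orG hl, mem_orSucc_decision hu,
      acceptsFrom_decision hu]
    constructor
    · rintro ⟨_, ⟨c, rfl⟩, hs⟩
      obtain ⟨rfl, h⟩ := (key c).1 hs
      exact h
    · exact fun h => ⟨_, ⟨a i, rfl⟩, (key (a i)).2 ⟨rfl, h⟩⟩
  · have key v (hv : v ∈ G.orSucc u) :=
      hG.satAt_main a v (hr.tail (Or.inr ⟨hu, hv⟩))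
    simp only [NNF.satAt_orG hl, mem_orSucc_orNode hu,
      acceptsFrom_orNode hu]
    constructor
    · rintro ⟨_, ⟨-, v, hv, rfl⟩, hs⟩
      exact ⟨v, hv, (key v hv).1 hs⟩
    · rintro ⟨v, hv, hs⟩
      exact ⟨_, ⟨hr, v, hv, rfl⟩, (key v hv).2 hs⟩
  · rw [NNF.satAt_const hl, acceptsFrom_sink hu]
termination_by G.size - u
decreasing_by
  · have := lt_branch hu c
    omega
  · have := G.orSucc_lt u v hu hv
    omega

variable (G) in
/-- The variables that may occur below the gates simulating a node. -/
def gateVars : Fin G.size × GateKind → Set (Fin n)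
  | (u, .lit _) => {i | G.label u = .decision i}
  | (u, _) => G.varsAt u

lemma gateVars_subset (u : Fin G.size) (k : GateKind) : G.gateVars (u, k) ⊆ G.varsAt u := by
  rcases k with c | c | _
  · exact fun i hi => mem_varsAt_self hi
  · exact subset_rfl
  · exact subset_rfl

lemma varsAt_gate_subset (u : Fin G.size) (k : GateKind) :
    (G.toNNF π).varsAt (gate G π u k) ⊆ G.gateVars (u, k) := by
  have h := NNF.varsAt_subset_of_monotone (D := G.toNNF π)
    (fun g => G.gateVars ((equiv G.size).symm g)) ?_ ?_ (gate G π u k)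
  · simpa [gate] using h
  · intro g i c hg
    obtain ⟨u, k, rfl⟩ := exists_eq_gate g
    rw [label_gate] at hg
    have hu := gateLabel_eq_lit hg
    simp only [gate, Equiv.symm_apply_apply]
    rcases k with d | d | _
    · exact hu
    · exact mem_varsAt_self hu
    · exact mem_varsAt_self hu
  · intro g g' hg
    obtain ⟨u, k, rfl⟩ := exists_eq_gate g
    rcases hg with ⟨hg, h⟩ | ⟨hg, h⟩ <;> rw [label_gate] at hg
    · obtain ⟨i, c, hu, rfl, -⟩ := gateLabel_eq_andG hg
      rw [andL_gate, andR_gate] at h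
      rcases h with rfl | rfl <;> simp only [gate, Equiv.symm_apply_apply]
      · exact gateVars_subset u _
      · exact varsAt_subset_of_edge (edge_branch hu c)
    · obtain ⟨rfl, ⟨i, hu⟩ | hu⟩ := gateLabel_eq_orG hg
      · obtain ⟨c, rfl⟩ := (mem_orSucc_decision hu).1 h
        simp only [gate, Equiv.symm_apply_apply]
        exact subset_rfl
      · obtain ⟨-, v, hv, rfl⟩ := (mem_orSucc_orNode hu).1 h
        simp only [gate, Equiv.symm_apply_apply]
        exact varsAt_subset_of_edge (Or.inr ⟨hu, hv⟩)

/-- A conjunction of the circuit separates a variable that is not last from variables that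
come later in the ordering. -/
lemma IsOBDD.exists_of_andG (hG : G.IsOBDD π) {g : Fin (G.toNNF π).size}
    (hg : (G.toNNF π).label g = .andG) :
    ∃ i, ¬ IsLast π i ∧ (G.toNNF π).varsAt ((G.toNNF π).andL g) ⊆ {i} ∧
      ∀ j ∈ (G.toNNF π).varsAt ((G.toNNF π).andR g), π.symm i < π.symm j := by
  obtain ⟨u, k, rfl⟩ := exists_eq_gate g
  rw [label_gate] at hg
  obtain ⟨i, c, hu, rfl, hi⟩ := gateLabel_eq_andG hg
  rw [andL_gate, andR_gate]
  refine ⟨i, hi, fun j hj => ?_, fun j hj => ?_⟩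
  · have hj : G.label u = .decision j := varsAt_gate_subset u _ hj
    rw [hu] at hj
    cases hj
    rfl
  · exact IsOBDDRel.rel_of_mem_varsAt hG hu (edge_branch hu c) (varsAt_gate_subset _ _ hj)

lemma IsOBDD.decomposable_toNNF (hG : G.IsOBDD π) : (G.toNNF π).Decomposable := by
  intro g hg
  obtain ⟨i, -, hL, hR⟩ := hG.exists_of_andG hg
  rw [Set.disjoint_left]
  intro j hj hj'
  obtain rfl : j = i := hL hj
  exact lt_irrefl _ (hR j hj')

lemma IsOBDD.deterministic_toNNF (hG : G.IsOBDD π) (hU : G.Unambiguous) :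
    (G.toNNF π).Deterministic := by
  have : Std.Irrefl fun i j => π.symm i < π.symm j := ⟨fun i => lt_irrefl (π.symm i)⟩
  rintro g g₁ g₂ hg h₁ h₂ hne a ⟨hs₁, hs₂⟩
  obtain ⟨u, k, rfl⟩ := exists_eq_gate g
  rw [label_gate] at hg
  obtain ⟨rfl, ⟨i, hu⟩ | hu⟩ := gateLabel_eq_orG hg
  · obtain ⟨c₁, rfl⟩ := (mem_orSucc_decision hu).1 h₁
    obtain ⟨c₂, rfl⟩ := (mem_orSucc_decision hu).1 h₂
    have h₁ := eq_of_satAt_branch hu hs₁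
    have h₂ := eq_of_satAt_branch hu hs₂
    exact hne (by rw [← h₁, ← h₂])
  · obtain ⟨hr, v₁, hv₁, rfl⟩ := (mem_orSucc_orNode hu).1 h₁
    obtain ⟨-, v₂, hv₂, rfl⟩ := (mem_orSucc_orNode hu).1 h₂
    obtain ⟨p, hp⟩ := (hG.satAt_main a v₁ (hr.tail (Or.inr ⟨hu, hv₁⟩))).1 hs₁
    obtain ⟨q, hq⟩ := (hG.satAt_main a v₂ (hr.tail (Or.inr ⟨hu, hv₂⟩))).1 hs₂
    have hpq := hU.of_reachable hG hr a _ _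
      (acceptingPathFrom_cons ((active_orNode hu).2 hv₁) hp)
      (acceptingPathFrom_cons ((active_orNode hu).2 hv₂) hq)
    obtain rfl := (List.cons.inj hpq).2
    have hv : v₁ = v₂ := Option.some.inj (hp.1.1.symm.trans hq.1.1)
    exact hne (by rw [hv])

end NBDD

/-- Every (sequence of) Boolean function(s) on `n` variables
representable by unambiguous nondeterministic OBDDs of size polynomial in `n`
can be represented by structured deterministic DNNFs (deterministic DNNFs
respecting some vtree) of size polynomial in `n`. -/
theorem statement3 (f : (n : ℕ) → (Fin n → Bool) → Bool)
    (h : ∃ c : ℕ, ∀ n : ℕ, ∃ (π : Equiv.Perm (Fin n)) (F : NBDD n),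
        F.Unambiguous ∧ F.IsOBDD π ∧ F.Represents (f n) ∧ F.size ≤ (n + 2) ^ c) :
    ∃ c : ℕ, ∀ n : ℕ, 0 < n → ∃ (D : NNF n) (T : Vtree n),
      T.IsVtreeFor ∧ D.Decomposable ∧ D.Deterministic ∧ D.RespectsVtree T ∧
      D.size ≤ (n + 2) ^ c ∧ D.Represents (f n) := by
  obtain ⟨c, h⟩ := h
  refine ⟨c + 3, fun n hn => ?_⟩
  obtain ⟨π, F, hU, hF, hrep, hsize⟩ := h n
  obtain ⟨T, hT, hsplit⟩ := Vtree.exists_isVtreeFor hn π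
  refine ⟨F.toNNF π, T, hT, hF.decomposable_toNNF, hF.deterministic_toNNF hU, ?_, ?_, ?_⟩
  · intro g hg
    obtain ⟨i, hi, hL, hR⟩ := hF.exists_of_andG hg
    obtain ⟨j, hij⟩ : ∃ j, π.symm i < π.symm j := by simpa [NBDD.IsLast] using hi
    obtain ⟨R, hTR, hR'⟩ := hsplit i j hij
    exact ⟨.leaf i, R, hTR, fun k hk => by simpa [Vtree.varsList] using hL hk,
      fun k hk => hR' k (hR k hk)⟩
  · calc F.size * 5 ≤ (n + 2) ^ c * (n + 2) ^ 3 :=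
          Nat.mul_le_mul hsize ((by norm_num : 5 ≤ 2 ^ 3).trans
            (Nat.pow_le_pow_left (by omega) 3))
      _ = (n + 2) ^ (c + 3) := (pow_add _ _ _).symm
  · intro a
    rw [hrep a]
    exact (hF.satAt_main a F.source .refl).symm

end BDDPaper
end

section
/- The indirect storage access function ISA_n can be represented by SDDs of size O(n²), and the hidden weighted bit function HWB_n and the weighted sum function WS_n can each be represented by SDDs of size O(n³). -/
namespace BDDPaper

/-- Sentential decision diagrams (as terms; the size of an SDD counts its
distinct subterms, i.e. the nodes of the corresponding DAG).
An SDD is a constant, a literal, or a decomposition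
`(p₁ ∧ s₁) ∨ … ∨ (p_ℓ ∧ s_ℓ)` given by the list of its prime/sub pairs. -/
inductive SDD (n : ℕ) where
  | const (b : Bool)
  | lit (i : Fin n) (pos : Bool)
  | decomp (elems : List (SDD n × SDD n))

namespace SDD

/-- Satisfaction: `Sat a C` holds iff the assignment `a` satisfies the Boolean
function represented by the SDD `C`. -/
inductive Sat {n : ℕ} (a : Fin n → Bool) : SDD n → Prop where
  | const : Sat a (.const true)
  | lit (i : Fin n) (pos : Bool) : a i = pos → Sat a (.lit i pos)
  | decomp {elems : List (SDD n × SDD n)} (p s : SDD n) :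
      (p, s) ∈ elems → Sat a p → Sat a s → Sat a (.decomp elems)

/-- Syntactic correctness of an SDD w.r.t. a vtree `T`: a constant or a literal
respects any vtree (containing the mentioned variable); a decomposition must
have its primes respecting the left subtree and its subs respecting the right
subtree of some internal node of `T`, and the primes must form a partition
(each satisfiable, pairwise disjoint — as functions —, covering all
assignments). -/
inductive Respects {n : ℕ} : SDD n → Vtree n → Prop where
  | const (b : Bool) (T : Vtree n) : Respects (.const b) T
  | lit (i : Fin n) (pos : Bool) (T : Vtree n) :
      i ∈ T.varsList → Respects (.lit i pos) T
  | decomp {elems : List (SDD n × SDD n)} {T L R : Vtree n} :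
      T.Subtree (.node L R) →
      (∀ pr ∈ elems, Respects pr.1 L) →
      (∀ pr ∈ elems, Respects pr.2 R) →
      (∀ pr ∈ elems, ∃ a, Sat a pr.1) →
      (∀ pr ∈ elems, ∀ pr' ∈ elems,
          (∀ a, Sat a pr.1 ↔ Sat a pr'.1) ∨ (∀ a, ¬ (Sat a pr.1 ∧ Sat a pr'.1))) →
      (∀ a : Fin n → Bool, ∃ pr ∈ elems, Sat a pr.1) →
      Respects (.decomp elems) T

/-- The (reflexive, transitive) subterm relation on SDDs. -/
inductive SubtermOf {n : ℕ} : SDD n → SDD n → Prop where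
  | refl (C : SDD n) : SubtermOf C C
  | prime {elems : List (SDD n × SDD n)} {p s C : SDD n} :
      (p, s) ∈ elems → SubtermOf C p → SubtermOf C (.decomp elems)
  | sub {elems : List (SDD n × SDD n)} {p s C : SDD n} :
      (p, s) ∈ elems → SubtermOf C s → SubtermOf C (.decomp elems)

/-- The size of an SDD: the number of its distinct subterms (= the number of
nodes of the corresponding circuit with maximal sharing). -/
noncomputable def size {n : ℕ} (C : SDD n) : ℕ :=
  Nat.card {D : SDD n // SubtermOf D C}

end SDD

end BDDPaper
namespace BDDPaper

/-- The number of ones in the input `x`. -/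
def weight {n : ℕ} (x : Fin n → Bool) : ℕ :=
  (Finset.univ.filter fun i : Fin n => x i = true).card

/-- The symmetric function `E^n_j`: value `1` iff exactly `j` inputs are `1`. -/
def Esym {n : ℕ} (j : ℕ) (x : Fin n → Bool) : Bool := decide (weight x = j)

/-- The hidden weighted bit function `HWB_n(x) = x_{‖x‖}` (with `x_0 := 0`).
The variables `x_1, …, x_n` are indexed by `Fin n`, so `x_k` is `x ⟨k-1, _⟩`. -/
def HWB {n : ℕ} (x : Fin n → Bool) : Bool :=
  if h : 0 < weight x then
    x ⟨weight x - 1, by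
      have hle : weight x ≤ n := by
        simpa [weight] using
          (Finset.card_filter_le (Finset.univ : Finset (Fin n))
            (fun i => x i = true))
      omega⟩
  else false

end BDDPaper
namespace BDDPaper

/-- The number `|a|₂` whose binary representation is `(a_{t-1}, …, a_0)`. -/
def addrVal {t : ℕ} (a : Fin t → Bool) : ℕ :=
  ∑ i : Fin t, if a i then 2 ^ (i : ℕ) else 0

/-- The number `|x(i)|₂` whose binary representation is the block
`(x_{ik}, …, x_{(i+1)k-1})` (read with `x_{ik}` as the most significant
bit). -/
def blockVal {n : ℕ} (k : ℕ) (x : Fin n → Bool) (i : ℕ) : ℕ :=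
  ∑ j ∈ Finset.range k,
    if h : i * k + j < n then (if x ⟨i * k + j, h⟩ then 2 ^ (k - 1 - j) else 0)
    else 0

/-- The indirect storage access function
`ISA_n(a, x) = x_{|x(a)|₂}` where `x(a)` is the block of `k` consecutive
`x`-bits addressed by `|a|₂`. -/
def ISA {t n : ℕ} (k : ℕ) (a : Fin t → Bool) (x : Fin n → Bool) : Bool :=
  if h : blockVal k x (addrVal a) < n then x ⟨blockVal k x (addrVal a), h⟩
  else false

end BDDPaper
namespace BDDPaper

/-- The smallest prime larger than `n`. -/
noncomputable def smallestPrimeAbove (n : ℕ) : ℕ :=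
  sInf {p : ℕ | p.Prime ∧ n < p}

/-- The weighted sum `S = (Σ i·x_i) mod p` computed in the field `Z_p`,
where `p` is the smallest prime larger than `n` (the variable `x_i`,
`1 ≤ i ≤ n`, is `x j` with `(j : ℕ) + 1 = i`). -/
noncomputable def wsSum {n : ℕ} (x : Fin n → Bool) : ℕ :=
  (∑ i : Fin n, if x i then ((i : ℕ) + 1) else 0) % smallestPrimeAbove n

/-- The weighted sum function `WS_n(x) = x_S` if `1 ≤ S ≤ n`, and
`WS_n(x) = x_1` otherwise. -/
noncomputable def WS {n : ℕ} (x : Fin n → Bool) : Bool :=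
  if h : 1 ≤ wsSum x ∧ wsSum x ≤ n then x ⟨wsSum x - 1, by omega⟩
  else if h0 : 0 < n then x ⟨0, h0⟩
  else false
end BDDPaper

namespace BDDPaper

namespace Vtree

variable {n : ℕ}

theorem subtree_refl (T : Vtree n) : T.Subtree T := by
  cases T <;> simp [Subtree, subtrees]

theorem Subtree.trans {T S U : Vtree n} (h : T.Subtree S) (h' : S.Subtree U) : T.Subtree U := by
  induction T with
  | leaf i =>
    simp only [Subtree, subtrees, List.mem_singleton] at h
    subst h
    exact h'
  | node l r ihl ihr =>
    simp only [Subtree, subtrees, List.mem_cons, List.mem_append] at h ihl ihr ⊢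
    rcases h with rfl | h | h
    · simpa [Subtree, subtrees] using h'
    · exact .inr (.inl (ihl h))
    · exact .inr (.inr (ihr h))

theorem subtree_left (L R : Vtree n) : (node L R).Subtree L :=
  List.mem_cons_of_mem _ (List.mem_append_left _ (subtree_refl L))

/-- The left-linear vtree on the variables `0, …, m`, with the variable `m` closest to the root. -/
def leftLinear (n : ℕ) : (m : ℕ) → m < n → Vtree n
  | 0, h => leaf ⟨0, h⟩
  | m + 1, h => node (leftLinear n m (Nat.lt_of_succ_lt h)) (leaf ⟨m + 1, h⟩)

theorem mem_varsList_leftLinear {m : ℕ} (h : m < n) (i : Fin n) :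
    i ∈ (leftLinear n m h).varsList ↔ (i : ℕ) ≤ m := by
  induction m with
  | zero => simp [leftLinear, varsList, Fin.ext_iff]
  | succ m ih =>
    simp only [leftLinear, varsList, List.mem_append, ih, List.mem_singleton, Fin.ext_iff]
    omega

theorem nodup_varsList_leftLinear {m : ℕ} (h : m < n) : (leftLinear n m h).varsList.Nodup := by
  induction m with
  | zero => simp [leftLinear, varsList]
  | succ m ih =>
    simp only [leftLinear, varsList]
    refine List.Nodup.append (ih _) (List.nodup_singleton _) ?_
    intro i hi hi'
    rw [mem_varsList_leftLinear] at hi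
    simp only [List.mem_singleton] at hi'
    subst hi'
    simp at hi

theorem isVtreeFor_leftLinear {m : ℕ} (h : m < n) (hm : m + 1 = n) :
    (leftLinear n m h).IsVtreeFor :=
  ⟨nodup_varsList_leftLinear h, fun i => (mem_varsList_leftLinear h i).2 (by omega)⟩

theorem varsList_subset_of_subtree {T S : Vtree n} (h : T.Subtree S) :
    S.varsList ⊆ T.varsList := by
  induction T with
  | leaf i =>
    simp only [Subtree, subtrees, List.mem_singleton] at h
    subst h
    exact List.Subset.refl _
  | node l r ihl ihr =>
    simp only [Subtree, subtrees, List.mem_cons, List.mem_append] at h ihl ihr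
    rcases h with rfl | h | h
    · exact List.Subset.refl _
    · exact List.subset_append_of_subset_left _ (ihl h)
    · exact List.subset_append_of_subset_right _ (ihr h)

end Vtree

namespace SDD

variable {n : ℕ}

theorem Respects.of_subtree {C : SDD n} {S T : Vtree n} (hC : C.Respects S) (h : T.Subtree S) :
    C.Respects T := by
  cases hC with
  | const b => exact .const b T
  | lit i pos _ hi => exact .lit i pos T (Vtree.varsList_subset_of_subtree h hi)
  | decomp h₁ h₂ h₃ h₄ h₅ h₆ => exact .decomp (h.trans h₁) h₂ h₃ h₄ h₅ h₆

/-- The constant or literal representing a Boolean function `g` of the single variable `i`. -/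
def ofBit (i : Fin n) (g : Bool → Bool) : SDD n :=
  if g false then (if g true then const true else lit i false)
  else (if g true then lit i true else const false)

theorem sat_const (x : Fin n → Bool) (b : Bool) : Sat x (const b) ↔ b = true :=
  ⟨fun h => by cases h; rfl, fun h => h ▸ .const⟩

theorem sat_lit (x : Fin n → Bool) (i : Fin n) (b : Bool) : Sat x (lit i b) ↔ x i = b :=
  ⟨fun h => by cases h; assumption, fun h => .lit i b h⟩

theorem sat_ofBit (x : Fin n → Bool) (i : Fin n) (g : Bool → Bool) :
    Sat x (ofBit i g) ↔ g (x i) = true := by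
  unfold ofBit
  cases h₀ : g false <;> cases h₁ : g true <;> cases hx : x i <;>
    simp [sat_const, sat_lit, h₀, h₁, hx]

theorem respects_ofBit {i : Fin n} {T : Vtree n} (hi : i ∈ T.varsList) (g : Bool → Bool) :
    (ofBit i g).Respects T := by
  unfold ofBit
  split_ifs
  exacts [.const _ _, .lit _ _ _ hi, .lit _ _ _ hi, .const _ _]

/-- The SDDs consisting of a single constant or literal. -/
def IsAtom (C : SDD n) : Prop := (∃ b, C = const b) ∨ ∃ i b, C = lit i b

theorem isAtom_ofBit (i : Fin n) (g : Bool → Bool) : (ofBit i g).IsAtom := by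
  unfold ofBit
  split_ifs
  exacts [.inl ⟨_, rfl⟩, .inr ⟨_, _, rfl⟩, .inr ⟨_, _, rfl⟩, .inl ⟨_, rfl⟩]

theorem SubtermOf.isAtom {C D : SDD n} (h : SubtermOf D C) (hC : C.IsAtom) : D.IsAtom := by
  cases h with
  | refl => exact hC
  | prime => simp [IsAtom] at hC
  | sub => simp [IsAtom] at hC

open Classical in
/-- The finite set of all constants and literals. -/
noncomputable def atoms (n : ℕ) : Finset (SDD n) :=
  Finset.univ.image const ∪ Finset.univ.image fun q : Fin n × Bool => lit q.1 q.2

theorem mem_atoms {C : SDD n} : C ∈ atoms n ↔ C.IsAtom := by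
  simp only [atoms, IsAtom, Finset.mem_union, Finset.mem_image, Finset.mem_univ, true_and,
    Prod.exists, eq_comm]

theorem card_atoms_le : (atoms n).card ≤ 2 + 2 * n := by
  classical
  refine (Finset.card_union_le _ _).trans (Nat.add_le_add ?_ ?_)
  · exact Finset.card_image_le.trans (by simp)
  · exact Finset.card_image_le.trans (by simp [mul_comm])

theorem size_le_card {C : SDD n} (s : Finset (SDD n)) (h : ∀ D, SubtermOf D C → D ∈ s) :
    C.size ≤ s.card := by
  have := Set.ncard_le_ncard (s := {D | SubtermOf D C}) (t := s) (fun D hD => h D hD)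
  rwa [Set.ncard_coe_finset] at this

variable {ι : Type*}

/-- The decomposition with primes `p i` whose subs are the functions `g i` of the variable `z`. -/
def mux (l : List ι) (p : ι → SDD n) (z : Fin n) (g : ι → Bool → Bool) : SDD n :=
  decomp (l.map fun i => (p i, ofBit z (g i)))

section mux

variable {l : List ι} {p : ι → SDD n} {z : Fin n} {g : ι → Bool → Bool}
  {κ : (Fin n → Bool) → ι}

theorem sat_mux (hl : ∀ i, i ∈ l ↔ ∃ x, κ x = i) (hp : ∀ i ∈ l, ∀ x, Sat x (p i) ↔ κ x = i)
    (x : Fin n → Bool) : Sat x (mux l p z g) ↔ g (κ x) (x z) = true := by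
  constructor
  · intro h
    unfold mux at h
    cases h with
    | decomp q s hm hq hs =>
      obtain ⟨i, hi, he⟩ := List.mem_map.1 hm
      obtain ⟨rfl, rfl⟩ := Prod.mk.inj he
      rw [(hp i hi x).1 hq]
      exact (sat_ofBit x z _).1 hs
  · intro h
    have hi := (hl (κ x)).2 ⟨x, rfl⟩
    exact .decomp _ _ (List.mem_map.2 ⟨κ x, hi, rfl⟩) ((hp _ hi x).2 rfl) ((sat_ofBit x z _).2 h)

theorem respects_mux {T L : Vtree n} (hT : T.Subtree (.node L (.leaf z)))
    (hl : ∀ i, i ∈ l ↔ ∃ x, κ x = i) (hp : ∀ i ∈ l, ∀ x, Sat x (p i) ↔ κ x = i)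
    (hL : ∀ i ∈ l, (p i).Respects L) : (mux l p z g).Respects T := by
  refine .decomp hT ?_ ?_ ?_ ?_ ?_
  · simpa using hL
  · simpa using fun i _ => respects_ofBit (by simp [Vtree.varsList]) _
  · simp only [List.forall_mem_map]
    intro i hi
    obtain ⟨x, hx⟩ := (hl i).1 hi
    exact ⟨x, (hp i hi x).2 hx⟩
  · simp only [List.forall_mem_map]
    intro i hi j hj
    by_cases h : i = j
    · exact .inl fun a => by rw [h]
    · refine .inr fun a ha => h ?_
      rw [← (hp i hi a).1 ha.1, (hp j hj a).1 ha.2]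
  · intro a
    have hi := (hl (κ a)).2 ⟨a, rfl⟩
    exact ⟨_, List.mem_map.2 ⟨κ a, hi, rfl⟩, (hp _ hi a).2 rfl⟩

theorem SubtermOf.of_mux {D : SDD n} (h : SubtermOf D (mux l p z g)) :
    D = mux l p z g ∨ (∃ i ∈ l, SubtermOf D (p i)) ∨ D.IsAtom := by
  generalize hC : mux l p z g = C at h
  cases h with
  | refl => exact .inl rfl
  | prime hm hD =>
    obtain rfl := SDD.decomp.inj hC
    obtain ⟨i, hi, he⟩ := List.mem_map.1 hm
    obtain ⟨rfl, rfl⟩ := Prod.mk.inj he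
    exact .inr (.inl ⟨i, hi, hD⟩)
  | sub hm hD =>
    obtain rfl := SDD.decomp.inj hC
    obtain ⟨i, hi, he⟩ := List.mem_map.1 hm
    obtain ⟨rfl, rfl⟩ := Prod.mk.inj he
    exact .inr (.inr (hD.isAtom (isAtom_ofBit _ _)))

end mux

end SDD

section Automaton

variable {n : ℕ} {K : Type*}

/-- The state reached by a (position dependent) automaton after reading the variables
`0, …, m`. -/
def run (step : Fin n → K → Bool → K) (s₀ : K) : (m : ℕ) → m < n → (Fin n → Bool) → K
  | 0, h, x => step ⟨0, h⟩ s₀ (x ⟨0, h⟩)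
  | m + 1, h, x => step ⟨m + 1, h⟩ (run step s₀ m (Nat.lt_of_succ_lt h) x) (x ⟨m + 1, h⟩)

open Classical in
/-- An SDD testing whether an automaton is in state `s` after reading the variables `0, …, m`;
variables that never change the state are skipped. -/
noncomputable def stateSDD [Fintype K] (step : Fin n → K → Bool → K) (s₀ : K) :
    (m : ℕ) → m < n → K → SDD n
  | 0, h, s => SDD.ofBit ⟨0, h⟩ fun b => decide (step ⟨0, h⟩ s₀ b = s)
  | m + 1, h, s =>
    if ∀ s' b, step ⟨m + 1, h⟩ s' b = s' then stateSDD step s₀ m (Nat.lt_of_succ_lt h) s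
    else SDD.mux
      (Finset.univ.filter fun s' => ∃ x, run step s₀ m (Nat.lt_of_succ_lt h) x = s').toList
      (stateSDD step s₀ m (Nat.lt_of_succ_lt h)) ⟨m + 1, h⟩
      fun s' b => decide (step ⟨m + 1, h⟩ s' b = s)

variable [Fintype K] (step : Fin n → K → Bool → K) (s₀ : K)

theorem sat_stateSDD {m : ℕ} (h : m < n) (s : K) (x : Fin n → Bool) :
    SDD.Sat x (stateSDD step s₀ m h s) ↔ run step s₀ m h x = s := by
  induction m generalizing s x with
  | zero => simp [stateSDD, SDD.sat_ofBit, run]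
  | succ m ih =>
    rw [stateSDD]
    split_ifs with hs
    · rw [ih, run, hs]
    · rw [SDD.sat_mux (κ := run step s₀ m (Nat.lt_of_succ_lt h)) (by simp)
        (fun i _ y => ih _ i y)]
      simp [run]

theorem respects_stateSDD {m : ℕ} (h : m < n) (s : K) :
    (stateSDD step s₀ m h s).Respects (Vtree.leftLinear n m h) := by
  induction m generalizing s with
  | zero => exact SDD.respects_ofBit (by simp [Vtree.leftLinear, Vtree.varsList]) _
  | succ m ih =>
    rw [stateSDD]
    split_ifs with hs
    · exact (ih (Nat.lt_of_succ_lt h) s).of_subtree (Vtree.subtree_left _ _)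
    · exact SDD.respects_mux (κ := run step s₀ m (Nat.lt_of_succ_lt h)) (Vtree.subtree_refl _)
        (by simp) (fun i _ y => sat_stateSDD step s₀ _ i y) fun i _ => ih _ i

open Classical in
/-- The nodes of the SDDs `stateSDD` at the positions where the automaton may change its state. -/
noncomputable def stateNodes (A : Finset (Fin n)) : Finset (SDD n) :=
  (A ×ˢ Finset.univ).image fun q : Fin n × K => stateSDD step s₀ q.1 q.1.2 q.2

theorem card_stateNodes_le (A : Finset (Fin n)) :
    (stateNodes step s₀ A).card ≤ A.card * Fintype.card K := by
  classical
  exact Finset.card_image_le.trans (by simp [Finset.card_product])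

theorem subterm_stateSDD {A : Finset (Fin n)} (hA : ∀ v ∉ A, ∀ s b, step v s b = s)
    {m : ℕ} (h : m < n) (s : K) {D : SDD n} (hD : SDD.SubtermOf D (stateSDD step s₀ m h s)) :
    D ∈ stateNodes step s₀ A ∨ D.IsAtom := by
  classical
  induction m generalizing s with
  | zero => exact .inr (hD.isAtom (SDD.isAtom_ofBit _ _))
  | succ m ih =>
    have hmem : (⟨m + 1, h⟩ : Fin n) ∈ A →
        stateSDD step s₀ (m + 1) h s ∈ stateNodes step s₀ A := fun hm =>
      Finset.mem_image.2 ⟨(⟨m + 1, h⟩, s), by simpa using hm, rfl⟩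
    rw [stateSDD] at hD hmem
    split_ifs at hD hmem with hs
    · exact ih _ s hD
    · rcases hD.of_mux with rfl | ⟨i, -, hi⟩ | hD
      · exact .inl (hmem (by_contra fun hm => hs (hA _ hm)))
      · exact ih _ i hi
      · exact .inr hD

end Automaton

section Certificate

variable {n q : ℕ}

/-- One step of the automaton that computes a weighted sum of its input and checks whether the
input agrees with `r` on `S`. -/
def certStep (c : Fin n → ZMod q) (S : Finset (Fin n)) (r : Fin n → Bool) (v : Fin n)
    (s : ZMod q × Bool) (b : Bool) : ZMod q × Bool :=
  (s.1 + if b then c v else 0, s.2 && decide (v ∈ S → b = r v))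

theorem run_certStep (c : Fin n → ZMod q) (S : Finset (Fin n)) (r : Fin n → Bool)
    {m : ℕ} (h : m < n) (x : Fin n → Bool) :
    run (certStep c S r) (0, true) m h x =
      (∑ v ∈ Finset.univ.filter (fun v : Fin n => (v : ℕ) ≤ m), if x v then c v else 0,
        decide (∀ v ∈ S, (v : ℕ) ≤ m → x v = r v)) := by
  induction m with
  | zero =>
    have hf : (Finset.univ.filter fun v : Fin n => (v : ℕ) ≤ 0) = {⟨0, h⟩} := by
      ext v; simp [Fin.ext_iff]
    rw [hf]
    simp only [run, certStep, Finset.sum_singleton, zero_add, Bool.true_and, Prod.mk.injEq,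
      true_and, decide_eq_decide]
    constructor
    · intro H v hv hv0
      obtain rfl : v = ⟨0, h⟩ := Fin.ext (by simpa using hv0)
      exact H hv
    · exact fun H hv => H _ hv le_rfl
  | succ m ih =>
    have hf : (Finset.univ.filter fun v : Fin n => (v : ℕ) ≤ m + 1) =
        insert ⟨m + 1, h⟩ (Finset.univ.filter fun v : Fin n => (v : ℕ) ≤ m) := by
      ext v
      simp only [Finset.mem_filter, Finset.mem_univ, true_and, Finset.mem_insert, Fin.ext_iff]
      omega
    rw [hf, Finset.sum_insert (by simp), run, ih, certStep]
    refine Prod.ext (add_comm _ _) ?_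
    simp only [← Bool.decide_and, decide_eq_decide]
    constructor
    · rintro ⟨H, H'⟩ v hv hvm
      by_cases he : v = ⟨m + 1, h⟩
      · subst he; exact H' hv
      · exact H v hv (by have := fun h' => he (Fin.ext h'); simp at this; omega)
    · exact fun H => ⟨fun v hv hvm => H v hv (by omega), fun hv => H _ hv le_rfl⟩

/-- Suppose that `f x` is determined by the last variable `z` and an index `idx x`, and that the
assignments with the same index as `r` are those which agree with `r` on `S r` and have the same
weighted sum (ignoring `z` in both cases). Then `f` has a small SDD. -/
theorem exists_sdd_of_certificate [NeZero q] {I : Type*} [Fintype I] {z : Fin n} {M B : ℕ}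
    (hz : (z : ℕ) = M + 1) (hn : M + 2 = n) (c : Fin n → ZMod q)
    (f : (Fin n → Bool) → Bool) (idx : (Fin n → Bool) → I) (F : I → Bool → Bool)
    (hf : ∀ x, f x = F (idx x) (x z)) (S : (Fin n → Bool) → Finset (Fin n))
    (hidx : ∀ x r, idx x = idx r ↔
      ((∑ v with v ≠ z, if x v then c v else 0) = ∑ v with v ≠ z, if r v then c v else 0) ∧
        ∀ v ∈ S r, v ≠ z → x v = r v)
    (hB : ∀ r, ∃ A : Finset (Fin n), A.card ≤ B ∧ S r ⊆ A ∧ ∀ v ∉ A, c v = 0) :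
    ∃ (T : Vtree n) (C : SDD n), T.IsVtreeFor ∧ C.Respects T ∧
      C.size ≤ Fintype.card I * (B * (q * 2)) + 2 * n + 3 ∧
      ∀ x, SDD.Sat x C ↔ f x = true := by
  classical
  choose A hAB hSA hA using hB
  have hM : M < n := by omega
  have hM' : M + 1 < n := by omega
  have hne : ∀ v : Fin n, v ≠ z ↔ (v : ℕ) ≤ M := fun v => by rw [Ne, Fin.ext_iff]; omega
  have hrep : ∀ i : I, ∃ r, (∃ x, idx x = i) → idx r = i := fun i => by
    by_cases h : ∃ x, idx x = i
    · exact ⟨h.choose, fun _ => h.choose_spec⟩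
    · exact ⟨fun _ => false, fun h' => absurd h' h⟩
  choose rep hrep using hrep
  let step := fun i : I => certStep c (S (rep i)) (rep i)
  let p := fun i : I => stateSDD (step i) (0, true) M hM
    (∑ v with v ≠ z, if rep i v then c v else 0, true)
  let l : List I := (Finset.univ.filter fun i => ∃ x, idx x = i).toList
  have hl : ∀ i, i ∈ l ↔ ∃ x, idx x = i := by simp [l]
  have hp : ∀ i ∈ l, ∀ x, SDD.Sat x (p i) ↔ idx x = i := by
    intro i hi x
    have hr := hrep i ((hl i).1 hi)
    conv_rhs => rw [← hr]
    rw [hidx, sat_stateSDD, run_certStep]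
    simp [hne]
  have hstep : ∀ i, ∀ v ∉ A (rep i), ∀ s b, step i v s b = s := by
    intro i v hv s b
    have hvS : v ∉ S (rep i) := fun h => hv (hSA _ h)
    simp [step, certStep, hA _ v hv, hvS]
  refine ⟨Vtree.leftLinear n (M + 1) hM', SDD.mux l p z F,
    Vtree.isVtreeFor_leftLinear _ hn, ?_, ?_, fun x => ?_⟩
  · refine SDD.respects_mux (L := Vtree.leftLinear n M hM) ?_ hl hp
      fun i _ => respects_stateSDD _ _ _ _
    have : z = ⟨M + 1, hM'⟩ := Fin.ext hz
    rw [this]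
    exact Vtree.subtree_refl _
  · let s := insert (SDD.mux l p z F) (SDD.atoms n ∪
      Finset.univ.biUnion fun i => stateNodes (step i) (0, true) (A (rep i)))
    have hs : ∀ D, SDD.SubtermOf D (SDD.mux l p z F) → D ∈ s := by
      intro D hD
      simp only [s, Finset.mem_insert, Finset.mem_union, Finset.mem_biUnion, Finset.mem_univ,
        true_and, SDD.mem_atoms]
      rcases hD.of_mux with h | ⟨i, -, hi⟩ | h
      · exact .inl h
      · rcases subterm_stateSDD _ _ (hstep i) _ _ hi with h | h
        · exact .inr (.inr ⟨i, h⟩)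
        · exact .inr (.inl h)
      · exact .inr (.inl h)
    refine (SDD.size_le_card s hs).trans ?_
    have h₁ : (Finset.univ.biUnion fun i => stateNodes (step i) (0, true) (A (rep i))).card ≤
        Fintype.card I * (B * (q * 2)) := by
      refine Finset.card_biUnion_le_card_mul _ _ _ fun i _ =>
        (card_stateNodes_le _ _ _).trans ?_
      simp only [Fintype.card_prod, ZMod.card, Fintype.card_bool]
      exact Nat.mul_le_mul_right _ (hAB _)
    have h₂ := Finset.card_insert_le (SDD.mux l p z F) (SDD.atoms n ∪
      Finset.univ.biUnion fun i => stateNodes (step i) (0, true) (A (rep i)))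
    have h₃ := Finset.card_union_le (SDD.atoms n)
      (Finset.univ.biUnion fun i => stateNodes (step i) (0, true) (A (rep i)))
    have h₄ := SDD.card_atoms_le (n := n)
    simp only [s]
    omega
  · rw [SDD.sat_mux hl hp, hf]

end Certificate

end BDDPaper

namespace BDDPaper

section WeightedSum

variable {n q : ℕ}

/-- A function that outputs the input bit selected by a weighted sum of the input in `ZMod q`
has an SDD of size `O(q²n)`. -/
theorem exists_sdd_of_weightedSum [NeZero q] (hn : 0 < n) (c : Fin n → ZMod q)
    (g : ZMod q → Option (Fin n)) (f : (Fin n → Bool) → Bool)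
    (hf : ∀ x, f x = (g (∑ v, if x v then c v else 0)).elim false x) :
    ∃ (T : Vtree n) (C : SDD n), T.IsVtreeFor ∧ C.Respects T ∧
      C.size ≤ 8 * q ^ 2 * n + 2 * n + 3 ∧ ∀ x, SDD.Sat x C ↔ f x = true := by
  classical
  obtain rfl | ⟨M, rfl⟩ : n = 1 ∨ ∃ M, n = M + 2 := by
    rcases n with _ | _ | M
    · omega
    · exact .inl rfl
    · exact .inr ⟨M, rfl⟩
  · refine ⟨.leaf 0, .ofBit 0 fun b => f fun _ => b, ⟨by simp [Vtree.varsList],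
      by simp [Vtree.varsList, Subsingleton.elim _ (0 : Fin 1)]⟩,
      SDD.respects_ofBit (by simp [Vtree.varsList]) _, ?_, fun x => ?_⟩
    · have := SDD.size_le_card (C := .ofBit 0 fun b => f fun _ => b) (SDD.atoms 1)
        fun D hD => SDD.mem_atoms.2 (hD.isAtom (SDD.isAtom_ofBit _ _))
      have := SDD.card_atoms_le (n := 1)
      omega
    · have hx : (fun _ => x 0) = x := funext fun i => by rw [Subsingleton.elim i 0]
      rw [SDD.sat_ofBit, hx]
  · let z : Fin (M + 2) := Fin.last _
    let w : (Fin (M + 2) → Bool) → ZMod q := fun x => ∑ v with v ≠ z, if x v then c v else 0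
    let g' : Bool → ZMod q → Option (Fin (M + 2)) := fun b s => g (s + if b then c z else 0)
    have hupd : ∀ b x, f (Function.update x z b) =
        (g' b (w x)).elim false (Function.update x z b) := by
      intro b x
      have hw : (∑ v, if Function.update x z b v then c v else 0) =
          w x + if b then c z else 0 := by
        rw [← Finset.sum_filter_add_sum_filter_not _ (fun v => v ≠ z)]
        congr 1
        · refine Finset.sum_congr rfl fun v hv => ?_
          rw [Function.update_of_ne (Finset.mem_filter.1 hv).2]
        · simp [Finset.sum_filter]
      rw [hf, hw]
    let idx : (Fin (M + 2) → Bool) → ZMod q × Bool × Bool := fun x =>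
      (w x, f (Function.update x z false), f (Function.update x z true))
    let S : (Fin (M + 2) → Bool) → Finset (Fin (M + 2)) := fun r =>
      Finset.univ.filter fun v => ∃ b, g' b (w r) = some v
    have hidx : ∀ x r, idx x = idx r ↔ w x = w r ∧ ∀ v ∈ S r, v ≠ z → x v = r v := by
      intro x r
      have hkey : w x = w r → ((f (Function.update x z false) = f (Function.update r z false) ∧
          f (Function.update x z true) = f (Function.update r z true)) ↔
          ∀ b v, g' b (w r) = some v → v ≠ z → x v = r v) := by
        intro hw
        rw [← Bool.forall_bool (p := fun b =>
          f (Function.update x z b) = f (Function.update r z b))]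
        refine forall_congr' fun b => ?_
        rw [hupd, hupd, hw]
        cases hg : g' b (w r) with
        | none => simp
        | some u =>
          by_cases hu : u = z
          · simp [hu]
          · simp [hu]
      simp only [idx, S, Prod.mk.injEq, Finset.mem_filter, Finset.mem_univ, true_and]
      refine and_congr_right fun hw => (hkey hw).trans ?_
      exact ⟨fun H v ⟨b, hb⟩ => H b v hb, fun H b v hb => H v ⟨b, hb⟩⟩
    obtain ⟨T, C, h₁, h₂, h₃, h₄⟩ := exists_sdd_of_certificate (z := z) (M := M) (B := M + 2)
      (by simp [z]) rfl c f idx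
      (fun i b => if b then i.2.2 else i.2.1)
      (fun x => by
        have h := Function.update_eq_self z x
        cases hx : x z <;> rw [hx] at h <;> simp [idx, h])
      S hidx fun r => ⟨Finset.univ, by simp, Finset.subset_univ _, by simp⟩
    refine ⟨T, C, h₁, h₂, h₃.trans_eq ?_, h₄⟩
    simp only [Fintype.card_prod, ZMod.card, Fintype.card_bool]
    ring

theorem exists_sdd_HWB (hn : 0 < n) :
    ∃ (T : Vtree n) (C : SDD n), T.IsVtreeFor ∧ C.Respects T ∧ C.size ≤ 37 * n ^ 3 ∧
      ∀ x : Fin n → Bool, SDD.Sat x C ↔ HWB x = true := by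
  obtain ⟨T, C, h₁, h₂, h₃, h₄⟩ := exists_sdd_of_weightedSum (q := n + 1) hn (fun _ => 1)
    (fun s => if h : 0 < s.val then some ⟨s.val - 1, by have := s.val_lt; omega⟩ else none) HWB
    fun x => by
      have hw : weight x ≤ n := by
        simpa [weight] using Finset.card_filter_le Finset.univ fun i => x i = true
      have hs : (∑ v, if x v then (1 : ZMod (n + 1)) else 0).val = weight x := by
        rw [Finset.sum_boole, ZMod.val_natCast]
        exact Nat.mod_eq_of_lt (Nat.lt_succ_of_le hw)
      unfold HWB
      simp only [hs]
      split_ifs <;> rfl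
  refine ⟨T, C, h₁, h₂, h₃.trans ?_, h₄⟩
  have h : (n + 1) ^ 2 ≤ (2 * n) ^ 2 := Nat.pow_le_pow_left (by omega) 2
  have h' : n ≤ n ^ 3 := Nat.le_self_pow (by omega) n
  have h'' : 8 * (n + 1) ^ 2 * n ≤ 8 * (2 * n) ^ 2 * n := by gcongr
  have h''' : 8 * (2 * n) ^ 2 * n = 32 * n ^ 3 := by ring
  omega

theorem smallestPrimeAbove_spec (n : ℕ) :
    (smallestPrimeAbove n).Prime ∧ n < smallestPrimeAbove n := by
  obtain ⟨p, hp, hp'⟩ := Nat.exists_infinite_primes (n + 1)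
  exact Nat.sInf_mem (s := {p : ℕ | p.Prime ∧ n < p}) ⟨p, hp', hp⟩

theorem smallestPrimeAbove_le (hn : 0 < n) : smallestPrimeAbove n ≤ 2 * n := by
  obtain ⟨p, hp, hp', hp''⟩ := Nat.exists_prime_lt_and_le_two_mul n hn.ne'
  exact (Nat.sInf_le (show p ∈ {p : ℕ | p.Prime ∧ n < p} from ⟨hp, hp'⟩)).trans hp''

theorem exists_sdd_WS (hn : 0 < n) :
    ∃ (T : Vtree n) (C : SDD n), T.IsVtreeFor ∧ C.Respects T ∧ C.size ≤ 37 * n ^ 3 ∧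
      ∀ x : Fin n → Bool, SDD.Sat x C ↔ WS x = true := by
  have : NeZero (smallestPrimeAbove n) := ⟨(smallestPrimeAbove_spec n).1.ne_zero⟩
  obtain ⟨T, C, h₁, h₂, h₃, h₄⟩ := exists_sdd_of_weightedSum (q := smallestPrimeAbove n) hn
    (fun v => (((v : ℕ) + 1 : ℕ) : ZMod (smallestPrimeAbove n)))
    (fun s => if h : 1 ≤ s.val ∧ s.val ≤ n then some ⟨s.val - 1, by omega⟩ else some ⟨0, hn⟩) WS
    fun x => by
      have hs : (∑ v, if x v then (((v : ℕ) + 1 : ℕ) : ZMod (smallestPrimeAbove n)) else 0).val =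
          wsSum x := by
        rw [wsSum, ← ZMod.val_natCast]
        congr 1
        push_cast
        rfl
      unfold WS
      simp only [hs]
      split_ifs <;> rfl
  refine ⟨T, C, h₁, h₂, h₃.trans ?_, h₄⟩
  have h : smallestPrimeAbove n ^ 2 ≤ (2 * n) ^ 2 :=
    Nat.pow_le_pow_left (smallestPrimeAbove_le hn) 2
  have h' : n ≤ n ^ 3 := Nat.le_self_pow (by omega) n
  have h'' : 8 * smallestPrimeAbove n ^ 2 * n ≤ 8 * (2 * n) ^ 2 * n := by gcongr
  have h''' : 8 * (2 * n) ^ 2 * n = 32 * n ^ 3 := by ring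
  omega

end WeightedSum

section ISA

theorem blockVal_congr {n k i : ℕ} {x y : Fin n → Bool}
    (h : ∀ j < k, ∀ hj : i * k + j < n, x ⟨i * k + j, hj⟩ = y ⟨i * k + j, hj⟩) :
    blockVal k x i = blockVal k y i := by
  refine Finset.sum_congr rfl fun j hj => ?_
  split_ifs with hn h₁ h₂ h₂ <;> simp_all

variable {t n : ℕ}

/-- `ISA` as a function of the concatenation of the address vector and the data vector. -/
def jointISA (k : ℕ) (b : Fin (t + n) → Bool) : Bool :=
  ISA k (fun i : Fin t => b (Fin.castAdd n i)) fun j : Fin n => b (Fin.natAdd t j)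

theorem exists_sdd_ISA {k : ℕ} (ht : 0 < t) (hn : 0 < n) :
    ∃ (T : Vtree (t + n)) (C : SDD (t + n)), T.IsVtreeFor ∧ C.Respects T ∧
      C.size ≤ 2 ^ t * 2 ^ k * 4 * ((t + k + 2) * 2) + 2 * (t + n) + 3 ∧
      ∀ b, SDD.Sat b C ↔ jointISA k b = true := by
  classical
  let z : Fin (t + n) := ⟨t + n - 1, by omega⟩
  have hzt : ∀ i : Fin t, Fin.castAdd n i ≠ z := fun i h => by
    have := congrArg Fin.val h
    simp only [Fin.val_castAdd, z] at this
    omega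
  let addr : (Fin (t + n) → Bool) → Fin t → Bool := fun x i => x (Fin.castAdd n i)
  let data : Bool → (Fin (t + n) → Bool) → Fin n → Bool := fun b x j =>
    Function.update x z b (Fin.natAdd t j)
  let target : Bool → (Fin (t + n) → Bool) → ℕ := fun b x =>
    blockVal k (data b x) (addrVal (addr x))
  have hupd : ∀ b x, jointISA k (Function.update x z b) =
      if h : target b x < n then data b x ⟨target b x, h⟩ else false := by
    intro b x
    have : (fun i : Fin t => Function.update x z b (Fin.castAdd n i)) = addr x :=
      funext fun i => Function.update_of_ne (hzt i) _ _
    rw [jointISA, this]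
    rfl
  have hdata : ∀ b (x r : Fin (t + n) → Bool) (j : Fin n),
      (Fin.natAdd t j ≠ z → x (Fin.natAdd t j) = r (Fin.natAdd t j)) →
        data b x j = data b r j := by
    intro b x r j h
    by_cases hj : Fin.natAdd t j = z
    · simp [data, hj]
    · simp [data, Function.update_of_ne hj, h hj]
  have hdata' : ∀ b (x r : Fin (t + n) → Bool) (j : Fin n), data b x j = data b r j →
      Fin.natAdd t j ≠ z → x (Fin.natAdd t j) = r (Fin.natAdd t j) := by
    intro b x r j h hj
    simpa [data, Function.update_of_ne hj] using h
  let block : (Fin (t + n) → Bool) → Fin k → Bool := fun x j =>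
    if h : addrVal (addr x) * k + j < n then data false x ⟨_, h⟩ else false
  let S : (Fin (t + n) → Bool) → Finset (Fin (t + n)) := fun r => Finset.univ.filter fun v =>
    (v : ℕ) < t ∨ (∃ j < k, (v : ℕ) = t + (addrVal (addr r) * k + j)) ∨
      ∃ b, (v : ℕ) = t + target b r
  have htarget : ∀ b x r, addr x = addr r → block x = block r → target b x = target b r := by
    intro b x r ha hb
    simp only [target, ha]
    refine blockVal_congr fun j hj hjn => hdata b x r _ fun hz => ?_
    have := congrFun hb ⟨j, hj⟩
    simp only [block, ha, hjn, dite_true] at this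
    exact hdata' _ _ _ _ this hz
  let idx : (Fin (t + n) → Bool) → (Fin t → Bool) × (Fin k → Bool) × Bool × Bool := fun x =>
    (addr x, block x, jointISA k (Function.update x z false), jointISA k (Function.update x z true))
  have hidx : ∀ x r, idx x = idx r ↔ ∀ v ∈ S r, v ≠ z → x v = r v := by
    intro x r
    simp only [idx, Prod.mk.injEq]
    constructor
    · rintro ⟨ha, hb, hf, ht⟩ v hv hvz
      have hf' : ∀ b, jointISA k (Function.update x z b) = jointISA k (Function.update r z b) :=
        fun b => by cases b <;> assumption
      have hv' : ∀ j, (v : ℕ) = t + j → ∃ h : j < n, v = Fin.natAdd t ⟨j, h⟩ := fun j hj =>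
        ⟨by omega, Fin.ext hj⟩
      simp only [S, Finset.mem_filter, Finset.mem_univ, true_and] at hv
      rcases hv with hv | ⟨j, hj, hv⟩ | ⟨b, hv⟩
      · exact congrFun ha ⟨v, hv⟩
      · obtain ⟨h, rfl⟩ := hv' _ hv
        have := congrFun hb ⟨j, hj⟩
        simp only [block, ha, h, dite_true] at this
        exact hdata' _ _ _ _ this hvz
      · obtain ⟨h, rfl⟩ := hv' _ hv
        have := hf' b
        rw [hupd, hupd] at this
        simp only [htarget b x r ha hb, h, dite_true] at this
        exact hdata' _ _ _ _ this hvz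
    · intro H
      simp only [S, Finset.mem_filter, Finset.mem_univ, true_and] at H
      have ha : addr x = addr r := funext fun i => H _ (.inl i.2) (hzt i)
      have hb : block x = block r := by
        funext j
        simp only [block, ha]
        split_ifs with h
        · exact hdata _ _ _ _ (H _ (.inr (.inl ⟨j, j.2, rfl⟩)))
        · rfl
      have hf : ∀ b, jointISA k (Function.update x z b) = jointISA k (Function.update r z b) := by
        intro b
        rw [hupd, hupd]
        simp only [htarget b x r ha hb]
        split_ifs with h
        · exact hdata _ _ _ _ (H _ (.inr (.inr ⟨b, rfl⟩)))
        · rfl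
      exact ⟨ha, hb, hf _, hf _⟩
  have hS : ∀ r, (S r).card ≤ t + k + 2 := by
    intro r
    rw [← Finset.card_map Fin.valEmbedding]
    have hsub : (S r).map Fin.valEmbedding ⊆ Finset.range t ∪
        (Finset.range k).image (fun j => t + (addrVal (addr r) * k + j)) ∪
        Finset.univ.image fun b => t + target b r := by
      intro v hv
      obtain ⟨u, hu, rfl⟩ := Finset.mem_map.1 hv
      simp only [S, Finset.mem_filter, Finset.mem_univ, true_and] at hu
      simp only [Fin.valEmbedding_apply, Finset.mem_union, Finset.mem_range, Finset.mem_image,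
        Finset.mem_univ, true_and]
      rcases hu with hu | ⟨j, hj, hu⟩ | ⟨b, hu⟩
      · exact .inl (.inl hu)
      · exact .inl (.inr ⟨j, hj, hu.symm⟩)
      · exact .inr ⟨b, hu.symm⟩
    refine (Finset.card_le_card hsub).trans ((Finset.card_union_le _ _).trans
      (Nat.add_le_add ((Finset.card_union_le _ _).trans (Nat.add_le_add ?_ ?_)) ?_))
    · simp
    · exact Finset.card_image_le.trans (by simp)
    · exact Finset.card_image_le.trans (by simp)
  obtain ⟨T, C, h₁, h₂, h₃, h₄⟩ := exists_sdd_of_certificate (q := 1) (z := z) (M := t + n - 2)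
    (B := t + k + 2) (by simp only [z]; omega) (by omega) (fun _ => 0) (jointISA k)
    idx (fun i b => if b then i.2.2.2 else i.2.2.1)
    (fun x => by
        have h := Function.update_eq_self z x
        cases hx : x z <;> rw [hx] at h <;> simp [idx, h])
    S (fun x r => by simpa using hidx x r) fun r => ⟨S r, hS r, subset_rfl, by simp⟩
  refine ⟨T, C, h₁, h₂, h₃.trans_eq ?_, h₄⟩
  simp only [Fintype.card_prod, Fintype.card_bool, Fintype.card_fun, Fintype.card_fin]
  ring

theorem ISA_size_bound {ℓ k n : ℕ} (hk : k = 2 ^ ℓ) (hn : n = 2 ^ k) :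
    2 ^ (k - ℓ) * 2 ^ k * 4 * ((k - ℓ + k + 2) * 2) + 2 * (k - ℓ + n) + 3 ≤ 39 * n ^ 2 := by
  have hℓ : ℓ < k := hk ▸ Nat.lt_two_pow_self
  have hkn : k < n := hn ▸ Nat.lt_two_pow_self
  have hmul : 2 ^ (k - ℓ) * k = n := by
    nth_rewrite 2 [hk]
    rw [← pow_add, Nat.sub_add_cancel hℓ.le, hn]
  have h₁ : 2 ^ (k - ℓ) * 2 ^ k * 4 * ((k - ℓ + k + 2) * 2) ≤
      2 ^ (k - ℓ) * n * 4 * ((4 * k) * 2) := by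
    rw [← hn]
    gcongr
    omega
  have h₂ : 2 ^ (k - ℓ) * n * 4 * ((4 * k) * 2) = 32 * n ^ 2 := by
    rw [show 2 ^ (k - ℓ) * n * 4 * ((4 * k) * 2) = 32 * (2 ^ (k - ℓ) * k) * n by ring, hmul]
    ring
  have h₃ : n ≤ n ^ 2 := Nat.le_self_pow (by omega) n
  omega

end ISA

/-- The indirect storage access function `ISA_n` can be
represented by SDDs of size `O(n²)`, and the hidden weighted bit function
`HWB_n` and the weighted sum function `WS_n` can each be represented by SDDs
of size `O(n³)`. -/
theorem statement15 :
    (∃ c : ℕ, ∀ ℓ k n : ℕ, k = 2 ^ ℓ → n = 2 ^ k →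
      ∃ (T : Vtree ((k - ℓ) + n)) (C : SDD ((k - ℓ) + n)),
        T.IsVtreeFor ∧ C.Respects T ∧ C.size ≤ c * n ^ 2 ∧
        ∀ b : Fin ((k - ℓ) + n) → Bool,
          (SDD.Sat b C ↔
            ISA k (fun i : Fin (k - ℓ) => b (Fin.castAdd n i))
              (fun j : Fin n => b (Fin.natAdd (k - ℓ) j)) = true)) ∧
    (∃ c : ℕ, ∀ n : ℕ, 0 < n → ∃ (T : Vtree n) (C : SDD n),
        T.IsVtreeFor ∧ C.Respects T ∧ C.size ≤ c * n ^ 3 ∧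
        ∀ x : Fin n → Bool, (SDD.Sat x C ↔ HWB x = true)) ∧
    (∃ c : ℕ, ∀ n : ℕ, 0 < n → ∃ (T : Vtree n) (C : SDD n),
        T.IsVtreeFor ∧ C.Respects T ∧ C.size ≤ c * n ^ 3 ∧
        ∀ x : Fin n → Bool, (SDD.Sat x C ↔ WS x = true)) := by
  refine ⟨⟨39, fun ℓ k n hk hn => ?_⟩, ⟨37, fun n hn => exists_sdd_HWB hn⟩,
    ⟨37, fun n hn => exists_sdd_WS hn⟩⟩
  have hℓ : ℓ < k := hk ▸ Nat.lt_two_pow_self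
  obtain ⟨T, C, h₁, h₂, h₃, h₄⟩ := exists_sdd_ISA (t := k - ℓ) (n := n) (k := k) (by omega)
    (hn ▸ Nat.two_pow_pos k)
  exact ⟨T, C, h₁, h₂, h₃.trans (ISA_size_bound hk hn), h₄⟩

end BDDPaper
end
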